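/- arXiv:2005.03698 — 3 statements merged into one kernel-verified Lean document; each statement's English description precedes it below -/
import Mathlib

section
/- Fix 0 < v < 1. For 0 < θ ≤ θ̂ < 1, the Beta distribution with parameters θ(1 − v)/v and (1 − θ)(1 − v)/v is stochastically dominated by the Beta distribution with parameters θ̂(1 − v)/v and (1 − θ̂)(1 − v)/v; that is, if Y has the former distribution and Ŷ the latter, then P[Y ≤ x] ≥ P[Ŷ ≤ x] for all real x. -/
open MeasureTheory

/-- The Beta distribution on `ℝ` with parameters `a, b`: the measure on the unit
interval with density proportional to `x ^ (a-1) * (1-x) ^ (b-1)`. -/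
noncomputable def betaMeasure (a b : ℝ) : Measure ℝ :=
  volume.withDensity (fun x => ENNReal.ofReal
    (if 0 < x ∧ x < 1 then
      (Real.Gamma (a + b) / (Real.Gamma a * Real.Gamma b)) * x ^ (a - 1) * (1 - x) ^ (b - 1)
    else 0))

/-- Stochastic dominance from the monotone likelihood ratio order. -/
theorem withDensity_Iic_le_of_likelihood_ratio {f g : ℝ → ENNReal} (hf : Measurable f)
    (hg : Measurable g) (hf1 : ∫⁻ x, f x = 1) (hg1 : ∫⁻ x, g x = 1)
    (h : ∀ s t, s ≤ t → g s * f t ≤ f s * g t) (x : ℝ) :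
    volume.withDensity g (Set.Iic x) ≤ volume.withDensity f (Set.Iic x) := by
  rw [withDensity_apply _ measurableSet_Iic, withDensity_apply _ measurableSet_Iic]
  have hcross : (∫⁻ s in Set.Iic x, g s) * (∫⁻ t in (Set.Iic x)ᶜ, f t)
      ≤ (∫⁻ s in Set.Iic x, f s) * (∫⁻ t in (Set.Iic x)ᶜ, g t) := by
    rw [← lintegral_mul_const _ hg, ← lintegral_mul_const _ hf]
    refine setLIntegral_mono' measurableSet_Iic fun s hs => ?_
    rw [← lintegral_const_mul _ hf, ← lintegral_const_mul _ hg]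
    refine setLIntegral_mono' measurableSet_Iic.compl fun t ht => h s t ?_
    simp only [Set.mem_compl_iff, Set.mem_Iic, not_le] at hs ht
    linarith
  have hfs := lintegral_add_compl (μ := volume) f (measurableSet_Iic (a := x))
  have hgs := lintegral_add_compl (μ := volume) g (measurableSet_Iic (a := x))
  rw [hf1] at hfs
  rw [hg1] at hgs
  calc (∫⁻ s in Set.Iic x, g s)
      = (∫⁻ s in Set.Iic x, g s) * ((∫⁻ s in Set.Iic x, f s) + ∫⁻ t in (Set.Iic x)ᶜ, f t) := by
        rw [hfs, mul_one]
    _ ≤ (∫⁻ s in Set.Iic x, f s) * ((∫⁻ s in Set.Iic x, g s) + ∫⁻ t in (Set.Iic x)ᶜ, g t) := by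
        rw [mul_add, mul_add, mul_comm (∫⁻ s in Set.Iic x, f s) (∫⁻ s in Set.Iic x, g s)]
        gcongr
    _ = ∫⁻ s in Set.Iic x, f s := by rw [hgs, mul_one]

theorem betaMeasure_eq_withDensity_betaPDF (a b : ℝ) :
    betaMeasure a b = volume.withDensity (ProbabilityTheory.betaPDF a b) := by
  unfold betaMeasure
  congr 1
  funext x
  rw [ProbabilityTheory.betaPDF_eq, ProbabilityTheory.beta, one_div_div]

theorem betaPDF_mul_betaPDF_le {a b a' b' : ℝ} (ha : 0 < a) (hb' : 0 < b') (haa' : a ≤ a')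
    (hbb' : b' ≤ b) {s t : ℝ} (hst : s ≤ t) :
    ProbabilityTheory.betaPDF a' b' s * ProbabilityTheory.betaPDF a b t
      ≤ ProbabilityTheory.betaPDF a b s * ProbabilityTheory.betaPDF a' b' t := by
  rcases le_or_gt s 0 with hs | hs
  · simp [ProbabilityTheory.betaPDF_eq_zero_of_nonpos hs]
  rcases le_or_gt 1 t with ht | ht
  · simp [ProbabilityTheory.betaPDF_eq_zero_of_one_le ht]
  have hs1 : 0 < 1 - s := by linarith
  have ht0 : 0 < t := by linarith
  have ht1 : 0 < 1 - t := by linarith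
  have hc := ProbabilityTheory.beta_pos ha (hb'.trans_le hbb')
  have hc' := ProbabilityTheory.beta_pos (ha.trans_le haa') hb'
  rw [ProbabilityTheory.betaPDF_of_pos_lt_one hs (by linarith),
    ProbabilityTheory.betaPDF_of_pos_lt_one ht0 ht,
    ProbabilityTheory.betaPDF_of_pos_lt_one hs (by linarith),
    ProbabilityTheory.betaPDF_of_pos_lt_one ht0 ht,
    ← ENNReal.ofReal_mul (by positivity), ← ENNReal.ofReal_mul (by positivity)]
  apply ENNReal.ofReal_le_ofReal
  have hpow : s ^ (a' - a) * (1 - t) ^ (b - b') ≤ t ^ (a' - a) * (1 - s) ^ (b - b') := by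
    gcongr
  have ea : a' - 1 = (a - 1) + (a' - a) := by ring
  have eb : b - 1 = (b' - 1) + (b - b') := by ring
  rw [ea, eb, Real.rpow_add hs, Real.rpow_add ht0, Real.rpow_add hs1, Real.rpow_add ht1]
  calc _ = (1 / ProbabilityTheory.beta a b * (1 / ProbabilityTheory.beta a' b')
          * s ^ (a - 1) * t ^ (a - 1) * (1 - s) ^ (b' - 1) * (1 - t) ^ (b' - 1))
          * (s ^ (a' - a) * (1 - t) ^ (b - b')) := by ring
    _ ≤ (1 / ProbabilityTheory.beta a b * (1 / ProbabilityTheory.beta a' b')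
          * s ^ (a - 1) * t ^ (a - 1) * (1 - s) ^ (b' - 1) * (1 - t) ^ (b' - 1))
          * (t ^ (a' - a) * (1 - s) ^ (b - b')) := by gcongr
    _ = _ := by ring

theorem betaMeasure_Iic_le {a b a' b' : ℝ} (ha : 0 < a) (hb' : 0 < b') (haa' : a ≤ a')
    (hbb' : b' ≤ b) (x : ℝ) :
    betaMeasure a' b' (Set.Iic x) ≤ betaMeasure a b (Set.Iic x) := by
  rw [betaMeasure_eq_withDensity_betaPDF, betaMeasure_eq_withDensity_betaPDF]
  exact withDensity_Iic_le_of_likelihood_ratio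
    (ProbabilityTheory.measurable_betaPDFReal a b).ennreal_ofReal
    (ProbabilityTheory.measurable_betaPDFReal a' b').ennreal_ofReal
    (ProbabilityTheory.lintegral_betaPDF_eq_one ha (hb'.trans_le hbb'))
    (ProbabilityTheory.lintegral_betaPDF_eq_one (ha.trans_le haa') hb')
    (fun _ _ hst => betaPDF_mul_betaPDF_le ha hb' haa' hbb' hst) x

/-- For `0 < v < 1` and `0 < θ ≤ θ̂ < 1`, the distribution
`Beta(θ(1−v)/v, (1−θ)(1−v)/v)` is stochastically dominated by
`Beta(θ̂(1−v)/v, (1−θ̂)(1−v)/v)`: if `Y` has the former distribution and `Ŷ` the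
latter, then `P[Y ≤ x] ≥ P[Ŷ ≤ x]` for every real `x`. -/
theorem stmt7 (v θ θhat : ℝ) (hv : 0 < v ∧ v < 1)
    (hθ : 0 < θ) (hle : θ ≤ θhat) (hθhat : θhat < 1) :
    ∀ x : ℝ,
      betaMeasure (θhat * (1 - v) / v) ((1 - θhat) * (1 - v) / v) (Set.Iic x)
        ≤ betaMeasure (θ * (1 - v) / v) ((1 - θ) * (1 - v) / v) (Set.Iic x) := by
  intro x
  obtain ⟨hv0, hv1⟩ := hv
  have h1v : 0 < 1 - v := by linarith
  have h1θ : 0 < 1 - θhat := by linarith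
  exact betaMeasure_Iic_le (by positivity) (by positivity) (by gcongr) (by gcongr) x
end

section
/- For every θ with 0 < θ < 1 there exists a unique h with 0 < h < ∞ such that 1 = ∑_{i=1}^n w_i / (θ + (1 − θ) ρ_i h). -/
open Finset

theorem add_one_sub_mul_mul_pos {θ r h : ℝ} (hθ : 0 < θ ∧ θ < 1) (hr : 0 < r) (hh : 0 ≤ h) :
    0 < θ + (1 - θ) * r * h := by
  have h1 : 0 ≤ (1 - θ) * r * h :=
    mul_nonneg (mul_nonneg (by linarith [hθ.2]) hr.le) hh
  linarith [hθ.1]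

theorem strictAntiOn_sum_div {ι : Type*} [Fintype ι] [Nonempty ι] {w ρ : ι → ℝ}
    (hw : ∀ i, 0 < w i) (hρ : ∀ i, 0 < ρ i) {θ : ℝ} (hθ : 0 < θ ∧ θ < 1) :
    StrictAntiOn (fun h : ℝ => ∑ i, w i / (θ + (1 - θ) * ρ i * h)) (Set.Ici 0) := by
  intro a ha b _ hab
  refine sum_lt_sum_of_nonempty univ_nonempty fun i _ => ?_
  have hc : 0 < (1 - θ) * ρ i := mul_pos (by linarith [hθ.2]) (hρ i)
  exact div_lt_div_of_pos_left (hw i) (add_one_sub_mul_mul_pos hθ (hρ i) ha)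
    (by linarith [mul_lt_mul_of_pos_left hab hc])

theorem continuousOn_sum_div {ι : Type*} [Fintype ι] {w ρ : ι → ℝ}
    (hρ : ∀ i, 0 < ρ i) {θ : ℝ} (hθ : 0 < θ ∧ θ < 1) :
    ContinuousOn (fun h : ℝ => ∑ i, w i / (θ + (1 - θ) * ρ i * h)) (Set.Ici 0) :=
  continuousOn_finsetSum _ fun i _ =>
    ContinuousOn.div (by fun_prop) (by fun_prop)
      fun _ hh => (add_one_sub_mul_mul_pos hθ (hρ i) hh).ne'

/-- For every `θ` with `0 < θ < 1` there is a unique `h` with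
`0 < h < ∞` such that `1 = ∑ i, w i / (θ + (1 − θ) ρ i h)`. -/
theorem stmt10 {n : ℕ} (hn : 1 ≤ n) (w ρ : Fin n → ℝ)
    (hw : ∀ i, 0 < w i ∧ w i < 1) (hwsum : ∑ i, w i = 1)
    (hρ : ∀ i, 0 < ρ i) (θ : ℝ) (hθ : 0 < θ ∧ θ < 1) :
    ∃! h : ℝ, 0 < h ∧ 1 = ∑ i, w i / (θ + (1 - θ) * ρ i * h) := by
  have : Nonempty (Fin n) := ⟨⟨0, hn⟩⟩
  have hanti := strictAntiOn_sum_div (fun i => (hw i).1) hρ hθ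
  have hH : 0 ≤ ∑ i, (ρ i)⁻¹ := sum_nonneg fun i _ => (inv_pos.2 (hρ i)).le
  have hzero : 1 < ∑ i, w i / (θ + (1 - θ) * ρ i * 0) := by
    simp only [mul_zero, add_zero, ← sum_div, hwsum]
    exact one_lt_one_div hθ.1 hθ.2
  have hlarge : ∑ i, w i / (θ + (1 - θ) * ρ i * ∑ j, (ρ j)⁻¹) ≤ 1 := by
    rw [← hwsum]
    refine sum_le_sum fun i _ => div_le_self (hw i).1.le ?_
    have h1 : (ρ i)⁻¹ ≤ ∑ j, (ρ j)⁻¹ :=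
      single_le_sum (f := fun j => (ρ j)⁻¹) (fun j _ => (inv_pos.2 (hρ j)).le) (mem_univ i)
    have h2 : 1 ≤ ρ i * ∑ j, (ρ j)⁻¹ := by
      simpa [(hρ i).ne'] using mul_le_mul_of_nonneg_left h1 (hρ i).le
    nlinarith [hθ.2]
  obtain ⟨h, hh, hsum⟩ := intermediate_value_Icc' hH
    ((continuousOn_sum_div (w := w) hρ hθ).mono Set.Icc_subset_Ici_self) ⟨hlarge, hzero.le⟩
  refine ⟨h, ⟨hh.1.lt_of_ne ?_, hsum.symm⟩, ?_⟩
  · rintro rfl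
    exact hzero.ne' hsum
  · rintro y ⟨hy, hysum⟩
    exact hanti.injOn hy.le hh.1 (hysum.symm.trans hsum.symm)
end

section
/- Let 0 < θ < θ̂ < 1, let h be the unique positive solution of 1 = ∑_{i=1}^n w_i / (θ + (1 − θ) ρ_i h) and ĥ the unique positive solution of 1 = ∑_{i=1}^n w_i / (θ̂ + (1 − θ̂) ρ_i ĥ). Then for every i = 1, …, n, θ / (θ + (1 − θ) ρ_i h) < θ̂ / (θ̂ + (1 − θ̂) ρ_i ĥ). -/
open Finset

/-- Normalising by `θ`: the fraction depends only on `s = (1 − θ) h / θ`. -/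
lemma div_add_mul_eq_inv {θ : ℝ} (hθ : 0 < θ) (r h : ℝ) :
    θ / (θ + (1 - θ) * r * h) = (1 + r * ((1 - θ) * h / θ))⁻¹ := by
  rw [← inv_div]
  congr 1
  field_simp

/-- A solution `h` of the normalisation equation recovers `θ` as a weighted mean. -/
lemma eq_sum_mul_inv_of_one_eq_sum {ι : Type*} [Fintype ι] (w ρ : ι → ℝ) {θ h : ℝ}
    (hθ : 0 < θ) (hsol : 1 = ∑ i, w i / (θ + (1 - θ) * ρ i * h)) :
    θ = ∑ i, w i * (1 + ρ i * ((1 - θ) * h / θ))⁻¹ := by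
  calc θ = θ * ∑ i, w i / (θ + (1 - θ) * ρ i * h) := by rw [← hsol, mul_one]
    _ = _ := by
      rw [Finset.mul_sum]
      refine Finset.sum_congr rfl fun i _ => ?_
      rw [← div_add_mul_eq_inv hθ]
      ring

/-- Let `0 < θ < θ̂ < 1`, let `h` be the unique positive solution of
`1 = ∑ i, w i / (θ + (1 − θ) ρ i h)` and `ĥ` the unique positive solution of
`1 = ∑ i, w i / (θ̂ + (1 − θ̂) ρ i ĥ)`. Then for every `i`,
`θ / (θ + (1 − θ) ρ i h) < θ̂ / (θ̂ + (1 − θ̂) ρ i ĥ)`. -/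
theorem stmt13 {n : ℕ} (hn : 1 ≤ n) (w ρ : Fin n → ℝ)
    (hw : ∀ i, 0 < w i ∧ w i < 1) (hwsum : ∑ i, w i = 1)
    (hρ : ∀ i, 0 < ρ i) (θ θhat : ℝ)
    (hθ : 0 < θ) (hlt : θ < θhat) (hθhat : θhat < 1)
    (h hhat : ℝ) (hh : 0 < h) (hhhat : 0 < hhat)
    (hsol : 1 = ∑ i, w i / (θ + (1 - θ) * ρ i * h))
    (hsolhat : 1 = ∑ i, w i / (θhat + (1 - θhat) * ρ i * hhat)) :
    ∀ i, θ / (θ + (1 - θ) * ρ i * h) < θhat / (θhat + (1 - θhat) * ρ i * hhat) := by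
  have hθhat₀ : 0 < θhat := hθ.trans hlt
  have ht : 0 < (1 - θhat) * hhat / θhat := div_pos (mul_pos (by linarith) hhhat) hθhat₀
  have hs : 0 < (1 - θ) * h / θ := div_pos (mul_pos (by linarith) hh) hθ
  have hmean := eq_sum_mul_inv_of_one_eq_sum w ρ hθ hsol
  have hmeanhat := eq_sum_mul_inv_of_one_eq_sum w ρ hθhat₀ hsolhat
  have hts : (1 - θhat) * hhat / θhat < (1 - θ) * h / θ := by
    by_contra! hst
    refine hlt.not_ge ?_
    rw [hmean, hmeanhat]
    refine Finset.sum_le_sum fun i _ => mul_le_mul_of_nonneg_left ?_ (hw i).1.le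
    exact inv_anti₀ (by linarith [mul_pos (hρ i) hs])
      (by linarith [mul_le_mul_of_nonneg_left hst (hρ i).le])
  intro i
  rw [div_add_mul_eq_inv hθ, div_add_mul_eq_inv hθhat₀]
  exact inv_strictAnti₀ (by linarith [mul_pos (hρ i) ht])
    (by linarith [mul_lt_mul_of_pos_left hts (hρ i)])
end
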